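/- Let R = ℚ[ℏ,𝔟] and define the rescaled Laplace–Beltrami operator D̃ on R[p̃] by D̃ := (ℏ/2) Σ_{k,ℓ≥1} kℓ · p̃_{k+ℓ} ∂_{p̃_k} ∂_{p̃_ℓ} + (ℏ/2) Σ_{k,ℓ≥1} (k+ℓ) · p̃_k p̃_ℓ ∂_{p̃_{k+ℓ}} − (ℏ𝔟/2) Σ_{k≥1} k(k−1) p̃_k ∂_{p̃_k} (each sum is locally finite on polynomials; equivalently, ℏ² D̃ = (1/2) Σ_{k≥1} J_{−k} ( Σ_{ℓ≥1} J_ℓ J_{k−ℓ} − (k−1)ℏ𝔟 J_k )). Then for every integer i ≥ 0 one has the identity of R-linear operators on R[p̃]: Ad_{D̃}^{i}(J_{−1}) = Σ_{γ ∈ Γ^{≥0}_{(0,−1)→(i+1,0)}} wt̃(γ|0), where the sum over bridges is locally finite. (This is Lemma 2.8 of the paper.) -/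

import Mathlib

open MvPolynomial

noncomputable section Stmt3

/-- The coefficient ring `R = ℚ[ℏ, 𝔟]`. -/
abbrev RR : Type := MvPolynomial (Fin 2) ℚ

/-- The ring `R[p̃] = R[p̃_1, p̃_2, …]` (variable `k` stands for `p̃_k`; index `0` is unused). -/
abbrev PP : Type := MvPolynomial ℕ RR

/-- The indeterminate `ℏ`. -/
def hb : RR := X 0

/-- The indeterminate `𝔟`. -/
def bb : RR := X 1

/-- The operators `J_k` on `R[p̃]`: `J_k = ℏ k ∂_{p̃_k}` for `k > 0`, `J_0 = 0`,
and `J_{-k} = ℏ·p̃_k` (multiplication) for `k > 0`. -/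
def J (k : ℤ) : PP → PP :=
  if 0 < k then fun p => C hb * (k.toNat : PP) * pderiv k.toNat p
  else if k < 0 then fun p => C hb * X (-k).toNat * p
  else 0

/-- The rescaled Laplace–Beltrami operator
`D̃ = (ℏ/2) Σ_{k,ℓ≥1} kℓ p̃_{k+ℓ} ∂_{p̃_k} ∂_{p̃_ℓ}
   + (ℏ/2) Σ_{k,ℓ≥1} (k+ℓ) p̃_k p̃_ℓ ∂_{p̃_{k+ℓ}}
   − (ℏ𝔟/2) Σ_{k≥1} k(k−1) p̃_k ∂_{p̃_k}`
(each sum is locally finite on polynomials; the summation indices below are shifted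
by one so that `k + 1, l + 1` range over `ℤ_{≥1}`). -/
def Dt : PP → PP := fun p =>
  (1 / 2 : ℚ) •
    (C hb *
        ((∑ᶠ k : ℕ, ∑ᶠ l : ℕ,
            (((k + 1) * (l + 1) : ℕ) : PP) * X (k + l + 2) *
              pderiv (k + 1) (pderiv (l + 1) p)) +
          ∑ᶠ k : ℕ, ∑ᶠ l : ℕ,
            ((k + l + 2 : ℕ) : PP) * X (k + 1) * X (l + 1) * pderiv (k + l + 2) p) -
      C (hb * bb) *
        ∑ᶠ k : ℕ, (((k + 1) * k : ℕ) : PP) * X (k + 1) * pderiv (k + 1) p)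

/-- The adjoint operator `Ad_A(B) = A∘B − B∘A` on (not necessarily linear) maps. -/
def adOp (A B : PP → PP) : PP → PP := fun p => A (B p) - B (A p)

/-- The set of paths from `(x, y)` to `(x + N, y')`, encoded as the list of the `N`
successive height increments. -/
def PathSet (y : ℤ) (N : ℕ) (y' : ℤ) : Set (List ℤ) :=
  {L | L.length = N ∧ y + L.sum = y'}

/-- The set of bridges from `(x, y)` to `(x + N, y')`: paths whose intermediate heights
`h_1, …, h_{N-1}` are all nonnegative. -/
def BridgeSet (y : ℤ) (N : ℕ) (y' : ℤ) : Set (List ℤ) :=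
  {L | L ∈ PathSet y N y' ∧ ∀ j : ℕ, 0 < j → j < N → 0 ≤ y + (L.take j).sum}

/-- The weight `wt̃(γ|u)` of a path: processed from the left, at (1-based) position `u`
and current height `y`, a non-flat step of increment `d` contributes the operator
`J_{-d}` (i.e. `J_{h_{j-1} - h_j}`), while a flat step contributes scalar multiplication
by `u_j − ℏ𝔟·h_j`. The first step's operator is applied last. -/
def wtT (uvec : ℕ → RR) : ℕ → ℤ → List ℤ → PP → PP
  | _, _, [] => id
  | u, y, d :: rest =>
      (if d = 0 then (fun p => C (uvec u - hb * bb * (y : RR)) * p) else J (-d)) ∘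
        wtT uvec (u + 1) (y + d) rest

lemma J_pos (k : ℕ) (q : PP) : J ((k : ℤ) + 1) q = C hb * ((k + 1 : ℕ) : PP) * pderiv (k + 1) q := by
  have h : (0 : ℤ) < (k : ℤ) + 1 := by omega
  have h2 : ((k : ℤ) + 1).toNat = k + 1 := by omega
  simp only [J, if_pos h, h2]

lemma J_neg (k : ℕ) (q : PP) : J (-((k : ℤ) + 1)) q = C hb * X (k + 1) * q := by
  have h : ¬ (0 : ℤ) < -((k : ℤ) + 1) := by omega
  have h1 : -((k : ℤ) + 1) < 0 := by omega
  have h2 : (-(-((k : ℤ) + 1))).toNat = k + 1 := by omega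
  simp only [J, if_neg h, if_pos h1, h2]

lemma J_zero (q : PP) : J 0 q = 0 := by simp [J]

lemma J_add (k : ℤ) (p q : PP) : J k (p + q) = J k p + J k q := by
  unfold J
  split_ifs <;> simp [mul_add]

def Jh (k : ℤ) : PP →+ PP := AddMonoidHom.mk' (J k) (J_add k)

@[simp] lemma Jh_apply (k : ℤ) (q : PP) : Jh k q = J k q := rfl

lemma pderiv_vanish (q : PP) : ∃ N : ℕ, ∀ n ≥ N, pderiv n q = 0 := by
  refine ⟨q.vars.sup id + 1, fun n hn => pderiv_eq_zero_of_notMem_vars fun h => ?_⟩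
  have := Finset.le_sup (f := id) h
  simp at this
  omega

lemma pderiv_swap (m n : ℕ) (q : PP) : pderiv m (pderiv n q) = pderiv n (pderiv m q) := by
  have h : ⁅(pderiv m : Derivation RR PP PP), (pderiv n : Derivation RR PP PP)⁆ = 0 := by
    apply MvPolynomial.derivation_ext (R := RR)
    intro i
    rw [Derivation.commutator_apply]
    simp only [pderiv_X, Pi.single_apply]
    split_ifs <;> simp
  have h2 := congrArg (fun d : Derivation RR PP PP => d q) h
  simp only [Derivation.commutator_apply] at h2
  exact sub_eq_zero.1 h2


section Generic

variable {A : Type*} [CommRing A]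

def ENg (h hh : A) (x : ℕ → A) (d : ℕ → A →+ A) (N : ℕ) (p : A) : A :=
    (h *
        ((∑ k ∈ Finset.range N, ∑ l ∈ Finset.range N,
            (((k + 1) * (l + 1) : ℕ) : A) * x (k + l + 2) *
              d (k + 1) (d (l + 1) p)) +
          ∑ k ∈ Finset.range N, ∑ l ∈ Finset.range N,
            ((k + l + 2 : ℕ) : A) * x (k + 1) * x (l + 1) * d (k + l + 2) p) -
      hh *
        ∑ k ∈ Finset.range N, (((k + 1) * k : ℕ) : A) * x (k + 1) * d (k + 1) p)

lemma ENg_add (h hh : A) (x : ℕ → A) (d : ℕ → A →+ A) (N : ℕ) (p q : A) :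
    ENg h hh x d N (p + q) = ENg h hh x d N p + ENg h hh x d N q := by
  simp only [ENg, map_add, mul_add, Finset.sum_add_distrib]
  ring

lemma sum_diag {f : ℕ → ℕ → A} (n N : ℕ) (hn : n < N) :
    ∑ k ∈ Finset.range N, ∑ l ∈ Finset.range N, (if k + l + 1 = n then f k l else 0)
      = ∑ k ∈ Finset.range n, f k (n - 1 - k) := by
  have h1 : ∀ k ∈ Finset.range N, ∑ l ∈ Finset.range N, (if k + l + 1 = n then f k l else 0)
      = if k < n then f k (n - 1 - k) else 0 := by
    intro k _
    split_ifs with hk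
    · rw [Finset.sum_eq_single (n - 1 - k)]
      · rw [if_pos (by omega)]
      · intro l _ hl
        rw [if_neg (by omega)]
      · intro hl
        simp at hl; omega
    · apply Finset.sum_eq_zero
      intro l _
      rw [if_neg (by omega)]
  rw [Finset.sum_congr rfl h1, ← Finset.sum_filter]
  apply Finset.sum_congr _ (fun _ _ => rfl)
  ext k; simp; omega

/-- commutator with multiplication by `x (n+1)` -/
lemma ENg_X (h hh : A) (x : ℕ → A) (d : ℕ → A →+ A)
    (dmul : ∀ i f g, d i (f * g) = d i f * g + f * d i g)
    (dX : ∀ i j, d i (x j) = if j = i then 1 else 0)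
    (n N : ℕ) (hn : n < N) (q : A) :
    ENg h hh x d N (x (n + 1) * q) - x (n + 1) * ENg h hh x d N q =
      h * (2 * ((n + 1 : ℕ) : A) * ∑ l ∈ Finset.range N, ((l + 1 : ℕ) : A) * x (n + l + 2) * d (l + 1) q
        + ((n + 1 : ℕ) : A) * ∑ k ∈ Finset.range n, x (k + 1) * x (n - k) * q)
      - hh * ((((n + 1) * n : ℕ) : A) * x (n + 1) * q) := by
  have hX : ∀ k, d (k + 1) (x (n + 1) : A) = if k = n then 1 else 0 := by
    intro k
    rw [dX]
    by_cases h : k = n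
    · simp [h]
    · rw [if_neg h, if_neg (by omega)]
  have hX1 : ∀ k, d (k + 1) (x (n + 1) * q : A) =
      (if k = n then q else 0) + x (n + 1) * d (k + 1) q := by
    intro k
    rw [dmul, hX]; split_ifs <;> simp
  have hX2 : ∀ k l, d (k + 1) (d (l + 1) (x (n + 1) * q : A)) =
      (if l = n then d (k + 1) q else 0) + (if k = n then d (l + 1) q else 0)
        + x (n + 1) * d (k + 1) (d (l + 1) q) := by
    intro k l
    rw [hX1, map_add, dmul, hX]; split_ifs <;> simp [add_assoc]
  have hX3 : ∀ k l, d (k + l + 2) (x (n + 1) * q : A) =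
      (if k + l + 1 = n then q else 0) + x (n + 1) * d (k + l + 2) q := 
    fun k l => hX1 (k + l + 1)
  have a1 : ∑ k ∈ Finset.range N, ∑ l ∈ Finset.range N,
            (((k + 1) * (l + 1) : ℕ) : A) * x (k + l + 2) *
              d (k + 1) (d (l + 1) (x (n + 1) * q)) =
      2 * ((n + 1 : ℕ) : A) * ∑ l ∈ Finset.range N, ((l + 1 : ℕ) : A) * x (n + l + 2) * d (l + 1) q
      + x (n + 1) * ∑ k ∈ Finset.range N, ∑ l ∈ Finset.range N,
            (((k + 1) * (l + 1) : ℕ) : A) * x (k + l + 2) *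
              d (k + 1) (d (l + 1) q) := by
    simp only [hX2, mul_add (R := A), Finset.sum_add_distrib, mul_ite, mul_zero, Finset.mul_sum]
    congr 1
    · have : ∀ k ∈ Finset.range N, ∑ l ∈ Finset.range N,
          (if k = n then (((k + 1) * (l + 1) : ℕ) : A) * x (k + l + 2) * d (l + 1) q else 0)
          = if k = n then ∑ l ∈ Finset.range N, (((k + 1) * (l + 1) : ℕ) : A) * x (k + l + 2) * d (l + 1) q else 0 := by
        intro k _; split_ifs <;> simp
      rw [Finset.sum_congr rfl this]
      simp only [Finset.sum_ite_eq', Finset.mem_range, hn, if_true]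
      rw [← Finset.sum_add_distrib]
      refine Finset.sum_congr rfl fun l _ => ?_
      rw [add_comm l n]
      push_cast; ring
    · refine Finset.sum_congr rfl fun k _ => Finset.sum_congr rfl fun l _ => ?_
      ring
  have a2 : ∑ k ∈ Finset.range N, ∑ l ∈ Finset.range N,
            ((k + l + 2 : ℕ) : A) * x (k + 1) * x (l + 1) * d (k + l + 2) (x (n + 1) * q) =
      ((n + 1 : ℕ) : A) * ∑ k ∈ Finset.range n, x (k + 1) * x (n - k) * q
      + x (n + 1) * ∑ k ∈ Finset.range N, ∑ l ∈ Finset.range N,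
            ((k + l + 2 : ℕ) : A) * x (k + 1) * x (l + 1) * d (k + l + 2) q := by
    simp only [hX3, mul_add (R := A), Finset.sum_add_distrib, mul_ite, mul_zero, Finset.mul_sum]
    congr 1
    · rw [sum_diag n N hn]
      refine Finset.sum_congr rfl fun k hk => ?_
      have hk' := Finset.mem_range.1 hk
      rw [show k + (n - 1 - k) + 2 = n + 1 by omega, show n - 1 - k + 1 = n - k by omega]
      ring
    · refine Finset.sum_congr rfl fun k _ => Finset.sum_congr rfl fun l _ => ?_
      ring
  have a3 : ∑ k ∈ Finset.range N, (((k + 1) * k : ℕ) : A) * x (k + 1) * d (k + 1) (x (n + 1) * q) =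
      (((n + 1) * n : ℕ) : A) * x (n + 1) * q
      + x (n + 1) * ∑ k ∈ Finset.range N, (((k + 1) * k : ℕ) : A) * x (k + 1) * d (k + 1) q := by
    simp only [hX1, mul_add (R := A), Finset.sum_add_distrib, mul_ite, mul_zero, Finset.mul_sum]
    congr 1
    · simp only [Finset.sum_ite_eq', Finset.mem_range, hn, if_true]
    · refine Finset.sum_congr rfl fun k _ => ?_
      ring
  unfold ENg
  rw [a1, a2, a3]
  ring

/-- commutator with `∂_{n+1}` -/
lemma ENg_D (h hh : A) (x : ℕ → A) (d : ℕ → A →+ A)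
    (dmul : ∀ i f g, d i (f * g) = d i f * g + f * d i g)
    (dX : ∀ i j, d i (x j) = if j = i then 1 else 0)
    (dcomm : ∀ i j f, d i (d j f) = d j (d i f))
    (dnat : ∀ i (m : ℕ), d i (m : A) = 0)
    (dh : ∀ i f, d i (h * f) = h * d i f) (dhh : ∀ i f, d i (hh * f) = hh * d i f) (n N : ℕ) (hn : n < N) (q : A) :
    ENg h hh x d N (d (n + 1) q) - d (n + 1) (ENg h hh x d N q) =
      - (h * ((∑ k ∈ Finset.range n, ((k + 1 : ℕ) : A) * ((n - k : ℕ) : A) * d (k + 1) (d (n - k) q))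
        + 2 * ∑ l ∈ Finset.range N, ((n + l + 2 : ℕ) : A) * x (l + 1) * d (n + l + 2) q)
      - hh * ((((n + 1) * n : ℕ) : A) * d (n + 1) q)) := by
  have hX : ∀ k, d (n + 1) (x (k + 1) : A) = if k = n then 1 else 0 := by
    intro k
    rw [dX]
    by_cases h : k = n
    · simp [h]
    · rw [if_neg h, if_neg (by omega)]
  have hX3 : ∀ k l, d (n + 1) (x (k + l + 2) : A) = if k + l + 1 = n then 1 else 0 := 
    fun k l => hX (k + l + 1)
  have hc : ∀ m : ℕ, d (n + 1) ((m : ℕ) : A) = 0 := fun m => dnat _ m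
  have a1 : d (n + 1) (∑ k ∈ Finset.range N, ∑ l ∈ Finset.range N,
            (((k + 1) * (l + 1) : ℕ) : A) * x (k + l + 2) *
              d (k + 1) (d (l + 1) q)) =
      ∑ k ∈ Finset.range n, ((k + 1 : ℕ) : A) * ((n - k : ℕ) : A) * d (k + 1) (d (n - k) q)
      + ∑ k ∈ Finset.range N, ∑ l ∈ Finset.range N,
            (((k + 1) * (l + 1) : ℕ) : A) * x (k + l + 2) *
              d (k + 1) (d (l + 1) (d (n + 1) q)) := by
    simp only [map_sum, dmul, hX3, hc, zero_mul, zero_add, mul_ite, mul_one, mul_zero,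
      ite_mul, Finset.sum_add_distrib]
    congr 1
    · rw [sum_diag n N hn]
      refine Finset.sum_congr rfl fun k hk => ?_
      have hk' := Finset.mem_range.1 hk
      rw [show n - 1 - k + 1 = n - k by omega]
      push_cast; ring
    · refine Finset.sum_congr rfl fun k _ => Finset.sum_congr rfl fun l _ => ?_
      rw [dcomm (n + 1) (k + 1), dcomm (n + 1) (l + 1)]
  have a2 : d (n + 1) (∑ k ∈ Finset.range N, ∑ l ∈ Finset.range N,
            ((k + l + 2 : ℕ) : A) * x (k + 1) * x (l + 1) * d (k + l + 2) q) =
      2 * (∑ l ∈ Finset.range N, ((n + l + 2 : ℕ) : A) * x (l + 1) * d (n + l + 2) q)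
      + ∑ k ∈ Finset.range N, ∑ l ∈ Finset.range N,
            ((k + l + 2 : ℕ) : A) * x (k + 1) * x (l + 1) * d (k + l + 2) (d (n + 1) q) := by
    simp only [map_sum, dmul, hX, hc, zero_mul, zero_add, mul_ite, mul_one, mul_zero,
      ite_mul, Finset.sum_add_distrib, add_mul]
    congr 1
    · have : ∀ k ∈ Finset.range N, ∑ l ∈ Finset.range N,
          (if k = n then (((k + l + 2 : ℕ) : A) * x (l + 1)) * d (k + l + 2) q else 0)
          = if k = n then ∑ l ∈ Finset.range N, ((k + l + 2 : ℕ) : A) * x (l + 1) * d (k + l + 2) q else 0 := by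
        intro k _; split_ifs <;> simp
      rw [Finset.sum_congr rfl this]
      simp only [Finset.sum_ite_eq', Finset.mem_range, hn, if_true, Finset.mul_sum]
      rw [← Finset.sum_add_distrib]
      refine Finset.sum_congr rfl fun l _ => ?_
      rw [add_comm l n]
      ring
    · refine Finset.sum_congr rfl fun k _ => Finset.sum_congr rfl fun l _ => ?_
      rw [dcomm (n + 1) (k + l + 2)]
  have a3 : d (n + 1) (∑ k ∈ Finset.range N, (((k + 1) * k : ℕ) : A) * x (k + 1) * d (k + 1) q) =
      (((n + 1) * n : ℕ) : A) * d (n + 1) q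
      + ∑ k ∈ Finset.range N, (((k + 1) * k : ℕ) : A) * x (k + 1) * d (k + 1) (d (n + 1) q) := by
    simp only [map_sum, dmul, hX, hc, zero_mul, zero_add, mul_ite, mul_one, mul_zero,
      ite_mul, Finset.sum_add_distrib]
    congr 1
    · simp only [Finset.sum_ite_eq', Finset.mem_range, hn, if_true]
    · refine Finset.sum_congr rfl fun k _ => ?_
      rw [dcomm (n + 1) (k + 1)]
  unfold ENg
  rw [map_sub, dh, dhh, map_add, a1, a2, a3]
  ring

end Generic


def pd (k : ℕ) : PP →+ PP := (pderiv k : Derivation RR PP PP).toLinearMap.toAddMonoidHom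

lemma pd_apply (k : ℕ) (q : PP) : pd k q = pderiv k q := rfl

def EN (N : ℕ) (p : PP) : PP := ENg (C hb) (C (hb * bb)) X pd N p

lemma EN_add (N : ℕ) (p q : PP) : EN N (p + q) = EN N p + EN N q := ENg_add _ _ _ _ _ _ _

lemma finsum_trunc (N : ℕ) (f : ℕ → PP) (h : ∀ k ≥ N, f k = 0) :
    ∑ᶠ k, f k = ∑ k ∈ Finset.range N, f k := by
  apply finsum_eq_sum_of_support_subset
  intro k hk
  simp only [Finset.coe_range, Set.mem_Iio]
  by_contra hc
  exact hk (h k (by omega))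

lemma Dt_trunc (p : PP) : ∃ N0 : ℕ, ∀ N ≥ N0, Dt p = (1 / 2 : ℚ) • EN N p := by
  obtain ⟨N0, h0⟩ := pderiv_vanish p
  refine ⟨N0, fun N hN => ?_⟩
  have h : ∀ n ≥ N, pderiv n p = 0 := fun n hn => h0 n (by omega)
  have s1 : (∑ᶠ k : ℕ, ∑ᶠ l : ℕ, (((k + 1) * (l + 1) : ℕ) : PP) * X (k + l + 2) *
              pderiv (k + 1) (pderiv (l + 1) p)) =
      ∑ k ∈ Finset.range N, ∑ l ∈ Finset.range N, (((k + 1) * (l + 1) : ℕ) : PP) * X (k + l + 2) *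
              pd (k + 1) (pd (l + 1) p) := by
    rw [finsum_trunc N]
    · refine Finset.sum_congr rfl fun k _ => ?_
      rw [finsum_trunc N]
      · rfl
      intro l hl
      rw [h (l + 1) (by omega), map_zero, mul_zero]
    · intro k hk
      rw [← finsum_zero (α := ℕ) (M := PP)]
      refine finsum_congr fun l => ?_
      rw [pderiv_swap, h (k + 1) (by omega), map_zero, mul_zero]
  have s2 : (∑ᶠ k : ℕ, ∑ᶠ l : ℕ,
            ((k + l + 2 : ℕ) : PP) * X (k + 1) * X (l + 1) * pderiv (k + l + 2) p) =
      ∑ k ∈ Finset.range N, ∑ l ∈ Finset.range N,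
            ((k + l + 2 : ℕ) : PP) * X (k + 1) * X (l + 1) * pd (k + l + 2) p := by
    rw [finsum_trunc N]
    · refine Finset.sum_congr rfl fun k _ => ?_
      rw [finsum_trunc N]
      · rfl
      intro l hl
      rw [h _ (by omega), mul_zero]
    · intro k hk
      rw [← finsum_zero (α := ℕ) (M := PP)]
      refine finsum_congr fun l => ?_
      rw [h _ (by omega), mul_zero]
  have s3 : (∑ᶠ k : ℕ, (((k + 1) * k : ℕ) : PP) * X (k + 1) * pderiv (k + 1) p) =
      ∑ k ∈ Finset.range N, (((k + 1) * k : ℕ) : PP) * X (k + 1) * pd (k + 1) p := by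
    rw [finsum_trunc N]
    · rfl
    intro l hl
    rw [h _ (by omega), mul_zero]
  unfold Dt EN ENg
  rw [s1, s2, s3]

lemma Dt_add (p q : PP) : Dt (p + q) = Dt p + Dt q := by
  obtain ⟨N1, h1⟩ := Dt_trunc p
  obtain ⟨N2, h2⟩ := Dt_trunc q
  obtain ⟨N3, h3⟩ := Dt_trunc (p + q)
  have e1 := h1 (N1 + N2 + N3) (by omega)
  have e2 := h2 (N1 + N2 + N3) (by omega)
  have e3 := h3 (N1 + N2 + N3) (by omega)
  rw [e1, e2, e3, EN_add, smul_add]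

def Dh : PP →+ PP := AddMonoidHom.mk' Dt Dt_add

@[simp] lemma Dh_apply (q : PP) : Dh q = Dt q := rfl

lemma two_half (x : PP) : (2 : PP) * ((1 / 2 : ℚ) • x) = x := by
  rw [two_mul, ← add_smul]
  norm_num

lemma pd_mul (i : ℕ) (f g : PP) : pd i (f * g) = pd i f * g + f * pd i g := pderiv_mul

lemma pd_X (i j : ℕ) : pd i (X j : PP) = if j = i then 1 else 0 := by
  rw [pd_apply, pderiv_X, Pi.single_apply]

lemma pd_nat (i m : ℕ) : pd i (m : PP) = 0 := Derivation.map_natCast (pderiv i : Derivation RR PP PP) m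

lemma pd_C (i : ℕ) (r : RR) (f : PP) : pd i (C r * f) = C r * pd i f := pderiv_C_mul

lemma EN_X (n N : ℕ) (hn : n < N) (q : PP) :
    EN N (X (n + 1) * q) - X (n + 1) * EN N q =
      C hb * (2 * ((n + 1 : ℕ) : PP) * ∑ l ∈ Finset.range N, ((l + 1 : ℕ) : PP) * X (n + l + 2) * pd (l + 1) q
        + ((n + 1 : ℕ) : PP) * ∑ k ∈ Finset.range n, X (k + 1) * X (n - k) * q)
      - C (hb * bb) * ((((n + 1) * n : ℕ) : PP) * X (n + 1) * q) :=
  ENg_X _ _ _ _ pd_mul pd_X n N hn q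

lemma EN_D (n N : ℕ) (hn : n < N) (q : PP) :
    EN N (pd (n + 1) q) - pd (n + 1) (EN N q) =
      - (C hb * ((∑ k ∈ Finset.range n, ((k + 1 : ℕ) : PP) * ((n - k : ℕ) : PP) * pd (k + 1) (pd (n - k) q))
        + 2 * ∑ l ∈ Finset.range N, ((n + l + 2 : ℕ) : PP) * X (l + 1) * pd (n + l + 2) q)
      - C (hb * bb) * ((((n + 1) * n : ℕ) : PP) * pd (n + 1) q)) :=
  ENg_D _ _ _ _ pd_mul pd_X pderiv_swap pd_nat (fun i f => pd_C i _ f) (fun i f => pd_C i _ f) n N hn q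

lemma sum_symm {A : Type*} [CommRing A] (n : ℕ) (g : ℕ → A)
    (hg : ∀ k < n, g (n - 1 - k) = g k) :
    2 * ∑ k ∈ Finset.range n, ((k : A) + 1) * g k = ((n : A) + 1) * ∑ k ∈ Finset.range n, g k := by
  have h1 : ∑ k ∈ Finset.range n, ((k : A) + 1) * g k
      = ∑ k ∈ Finset.range n, ((n : A) - k) * g k := by
    rw [← Finset.sum_range_reflect]
    refine Finset.sum_congr rfl fun k hk => ?_
    have hk' := Finset.mem_range.1 hk
    rw [hg k hk']
    congr 1
    have : ((n - 1 - k : ℕ) : A) + 1 + k = n := by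
      have : n - 1 - k + 1 + k = n := by omega
      exact_mod_cast congrArg (Nat.cast (R := A)) this
    rw [← this]; ring
  rw [two_mul]
  nth_rewrite 2 [h1]
  rw [← Finset.sum_add_distrib, Finset.mul_sum]
  refine Finset.sum_congr rfl fun k _ => ?_
  ring

lemma ENg_C {A : Type*} [CommRing A] (h hh : A) (x : ℕ → A) (d : ℕ → A →+ A) (N : ℕ) (s f : A)
    (hd : ∀ i g, d i (s * g) = s * d i g) : ENg h hh x d N (s * f) = s * ENg h hh x d N f := by
  have e1 : ∀ k l, (((k + 1) * (l + 1) : ℕ) : A) * x (k + l + 2) * d (k + 1) (d (l + 1) (s * f))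
      = s * ((((k + 1) * (l + 1) : ℕ) : A) * x (k + l + 2) * d (k + 1) (d (l + 1) f)) := by
    intro k l; rw [hd, hd]; ring
  have e2 : ∀ k l, ((k + l + 2 : ℕ) : A) * x (k + 1) * x (l + 1) * d (k + l + 2) (s * f)
      = s * (((k + l + 2 : ℕ) : A) * x (k + 1) * x (l + 1) * d (k + l + 2) f) := by
    intro k l; rw [hd]; ring
  have e3 : ∀ k, (((k + 1) * k : ℕ) : A) * x (k + 1) * d (k + 1) (s * f)
      = s * ((((k + 1) * k : ℕ) : A) * x (k + 1) * d (k + 1) f) := by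
    intro k; rw [hd]; ring
  unfold ENg
  simp only [e1, e2, e3, ← Finset.mul_sum]
  ring

lemma EN_C (N : ℕ) (r : RR) (f : PP) : EN N (C r * f) = C r * EN N f :=
  ENg_C _ _ _ _ _ _ _ (fun i g => pd_C i r g)

lemma Jp (k : ℕ) (q : PP) (n : ℤ) (h : n = (k : ℤ) + 1) :
    J n q = C hb * ((k : PP) + 1) * pd (k + 1) q := by
  subst h; rw [J_pos, pd_apply]; push_cast; rfl

lemma Jm (k : ℕ) (q : PP) (n : ℤ) (h : n = -((k : ℤ) + 1)) :
    J n q = C hb * X (k + 1) * q := by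
  subst h; rw [J_neg]

lemma J_half (n : ℤ) (x : PP) : 2 * J n ((1 / 2 : ℚ) • x) = J n x := by
  rw [two_mul, ← J_add, ← two_mul, two_half]

lemma comm_neg (n N : ℕ) (hn : n < N) (q : PP) :
    EN N (J (-((n : ℤ) + 1)) q) - J (-((n : ℤ) + 1)) (EN N q) =
    2 * (∑ k ∈ Finset.range n, ((k : PP) + 1) * J (-((k : ℤ) + 1)) (J (-((n : ℤ) - k)) q)
      + ∑ l ∈ Finset.range N, ((n : PP) + 1) * J (-((n : ℤ) + l + 2)) (J ((l : ℤ) + 1) q))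
    - C (hb * bb) * (((n : PP) + 1) * (n : PP)) * J (-((n : ℤ) + 1)) q := by
  have e1 : ∑ k ∈ Finset.range n, ((k : PP) + 1) * J (-((k : ℤ) + 1)) (J (-((n : ℤ) - k)) q)
      = ∑ k ∈ Finset.range n, ((k : PP) + 1) * (C hb * C hb * (X (k + 1) * X (n - k) * q)) := by
    refine Finset.sum_congr rfl fun k hk => ?_
    have hk' := Finset.mem_range.1 hk
    rw [Jm k _ _ rfl, Jm (n - k - 1) q _ (by omega), show n - k - 1 + 1 = n - k by omega]
    ring
  have e2 : ∑ l ∈ Finset.range N, ((n : PP) + 1) * J (-((n : ℤ) + l + 2)) (J ((l : ℤ) + 1) q)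
      = ((n : PP) + 1) * (C hb * C hb) *
        ∑ l ∈ Finset.range N, ((l + 1 : ℕ) : PP) * X (n + l + 2) * pd (l + 1) q := by
    rw [Finset.mul_sum]
    refine Finset.sum_congr rfl fun l hl => ?_
    rw [Jp l _ _ rfl, Jm (n + l + 1) _ _ (by push_cast; ring)]
    push_cast
    ring
  rw [mul_add (2 : PP), e1, e2, sum_symm, ← Finset.mul_sum, Jm n _ _ rfl, Jm n _ _ rfl,
    mul_assoc (C hb), EN_C, mul_assoc (C hb), ← mul_sub, EN_X n N hn]
  · push_cast
    ring
  · intro k hk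
    rw [show n - 1 - k + 1 = n - k by omega, show n - (n - 1 - k) = k + 1 by omega]
    ring

lemma comm_pos (n N : ℕ) (hn : n < N) (q : PP) :
    EN N (J ((n : ℤ) + 1) q) - J ((n : ℤ) + 1) (EN N q) =
    - (2 * (∑ k ∈ Finset.range n, ((k : PP) + 1) * J ((n : ℤ) - k) (J ((k : ℤ) + 1) q)
      + ∑ l ∈ Finset.range N, ((n : PP) + 1) * J (-((l : ℤ) + 1)) (J ((n : ℤ) + l + 2) q)))
    + C (hb * bb) * (((n : PP) + 1) * (n : PP)) * J ((n : ℤ) + 1) q := by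
  have hsc : (C hb * ((n : PP) + 1) : PP) = C (hb * ((n : RR) + 1)) := by simp
  have hJ : ∀ k < n, J ((n : ℤ) - k) (J ((k : ℤ) + 1) q)
      = C hb * C hb * (((k + 1 : ℕ) : PP) * ((n - k : ℕ) : PP) * pd (k + 1) (pd (n - k) q)) := by
    intro k hk
    have h2 : (C hb * ((k : PP) + 1) : PP) = C (hb * ((k : RR) + 1)) := by simp
    have h3 : (((n - k - 1 : ℕ) : PP) + 1) = ((n - k : ℕ) : PP) := by
      have : n - k - 1 + 1 = n - k := by omega
      exact_mod_cast congrArg (Nat.cast (R := PP)) this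
    rw [Jp k _ _ rfl, Jp (n - k - 1) _ _ (by omega), h2, pd_C, ← h2, h3,
      show n - k - 1 + 1 = n - k by omega, pd_apply, pd_apply, pderiv_swap, ← pd_apply, ← pd_apply]
    push_cast
    ring
  have e2 : ∑ l ∈ Finset.range N, ((n : PP) + 1) * J (-((l : ℤ) + 1)) (J ((n : ℤ) + l + 2) q)
      = ((n : PP) + 1) * (C hb * C hb) *
        ∑ l ∈ Finset.range N, ((n + l + 2 : ℕ) : PP) * X (l + 1) * pd (n + l + 2) q := by
    rw [Finset.mul_sum]
    refine Finset.sum_congr rfl fun l hl => ?_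
    rw [Jm l _ _ rfl, Jp (n + l + 1) _ _ (by push_cast; ring)]
    push_cast
    ring
  have e1 : ∑ k ∈ Finset.range n, J ((n : ℤ) - k) (J ((k : ℤ) + 1) q) = C hb * C hb *
      ∑ k ∈ Finset.range n, ((k + 1 : ℕ) : PP) * ((n - k : ℕ) : PP) * pd (k + 1) (pd (n - k) q) := by
    rw [Finset.mul_sum]
    exact Finset.sum_congr rfl fun k hk => hJ k (Finset.mem_range.1 hk)
  rw [mul_add (2 : PP), sum_symm, e1, e2, Jp n _ _ rfl, Jp n _ _ rfl, hsc, EN_C, ← mul_sub,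
    EN_D n N hn, ← hsc]
  · push_cast
    ring
  · intro k hk
    rw [hJ k hk, hJ _ (by omega), show n - 1 - k + 1 = n - k by omega,
      show n - (n - 1 - k) = k + 1 by omega, pd_apply, pd_apply, pderiv_swap, ← pd_apply, ← pd_apply]
    ring

lemma combine {A : Type*} [CommRing A] {a a' b b' c c' : A} (h1 : a = a') (h2 : b = b')
    (h3 : c = c') : 2 * (a + b) + c = 2 * (a' + b') + c' := by rw [h1, h2, h3]

lemma combine' {A : Type*} [CommRing A] {n m : ℕ} {f f' g g' : ℕ → A} {c c' : A}
    (h1 : ∀ k ∈ Finset.range n, - f k = f' k) (h2 : ∀ k ∈ Finset.range m, - g k = g' k)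
    (h3 : c = c') : - (2 * (∑ k ∈ Finset.range n, f k + ∑ k ∈ Finset.range m, g k)) + c
      = 2 * (∑ k ∈ Finset.range n, f' k + ∑ k ∈ Finset.range m, g' k) + c' := by
  rw [← Finset.sum_congr rfl h1, ← Finset.sum_congr rfl h2, Finset.sum_neg_distrib,
    Finset.sum_neg_distrib, h3]
  ring

lemma key (a : ℤ) (ha : -1 ≤ a) (b : ℕ) (q : PP) : ∃ N0 : ℕ, ∀ N ≥ N0,
    2 * (Dt (J (a - b) q) - J (a - b) (Dt q)) =
      2 * ∑ c ∈ Finset.range N, ((min (c : ℤ) b - min a c : ℤ) : PP) * J (a - c) (J (c - b) q)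
      + C (hb * bb) * (((a - b) * (|a - b| - 1) : ℤ) : PP) * J (a - b) q := by
  obtain ⟨N1, h1⟩ := Dt_trunc q
  obtain ⟨N2, h2⟩ := Dt_trunc (J (a - b) q)
  have hE : ∀ N' ≥ N1 + N2, 2 * (Dt (J (a - b) q) - J (a - b) (Dt q)) =
      EN N' (J (a - b) q) - J (a - b) (EN N' q) := by
    intro N' hN'
    rw [h1 N' (by omega), h2 N' (by omega), mul_sub, two_half, J_half]
  rcases lt_trichotomy a b with hab | hab | hab
  · obtain ⟨n, hn⟩ : ∃ n : ℕ, (b : ℤ) = a + n + 1 := ⟨(b - a - 1).toNat, by omega⟩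
    refine ⟨N1 + N2 + b + 2 + n, fun N hN => ?_⟩
    obtain ⟨N', rfl⟩ : ∃ N', N = (b - n) + n + 1 + N' := ⟨N - b - 1, by omega⟩
    have hab' : a - b = -((n : ℤ) + 1) := by omega
    rw [hE N' (by omega), hab', comm_neg n N' (by omega), Finset.sum_range_add,
      Finset.sum_range_succ, Finset.sum_range_add]
    have z1 : ∑ c ∈ Finset.range (b - n), ((min (c : ℤ) b - min a c : ℤ) : PP) *
        J (a - c) (J (c - b) q) = 0 := by
      apply Finset.sum_eq_zero
      intro c hc
      have hc' := Finset.mem_range.1 hc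
      rw [show (min (c : ℤ) b - min a c : ℤ) = 0 by omega]
      simp
    have z2 : J (((b - n + n : ℕ) : ℤ) - b) q = 0 := by
      rw [show (((b - n + n : ℕ) : ℤ) - b) = 0 by omega, J_zero]
    have z3 : |(-((n : ℤ) + 1))| - 1 = n := by rw [abs_neg, abs_of_nonneg (by omega)]; ring
    rw [z1, z2, z3, ← Jh_apply _ 0, map_zero, mul_zero, add_zero, zero_add, sub_eq_add_neg]
    refine combine ?_ ?_ ?_
    · · refine Finset.sum_congr rfl fun k hk => ?_
        have hk' := Finset.mem_range.1 hk
        rw [show (min ((b - n + k : ℕ) : ℤ) b - min a ((b - n + k : ℕ) : ℤ) : ℤ) = (k : ℤ) + 1 by omega,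
          show a - ((b - n + k : ℕ) : ℤ) = -((k : ℤ) + 1) by omega,
          show ((b - n + k : ℕ) : ℤ) - b = -((n : ℤ) - k) by omega]
        push_cast; rfl
    · · refine Finset.sum_congr rfl fun k hk => ?_
        rw [show (min ((b - n + n + 1 + k : ℕ) : ℤ) b - min a ((b - n + n + 1 + k : ℕ) : ℤ) : ℤ) = (n : ℤ) + 1 by omega,
          show a - ((b - n + n + 1 + k : ℕ) : ℤ) = -((n : ℤ) + k + 2) by omega,
          show ((b - n + n + 1 + k : ℕ) : ℤ) - b = (k : ℤ) + 1 by omega]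
        push_cast; rfl
    · push_cast; ring
  · refine ⟨0, fun N _ => ?_⟩
    rw [hE _ le_rfl, show a - b = 0 by omega, J_zero, J_zero, ← mul_zero (C (0 : RR)), EN_C,
      Finset.sum_eq_zero]
    · simp
    · intro c _
      rw [show (min (c : ℤ) b - min a c : ℤ) = 0 by omega]
      simp
  · obtain ⟨n, hn⟩ : ∃ n : ℕ, a = (b : ℤ) + n + 1 := ⟨(a - b - 1).toNat, by omega⟩
    refine ⟨N1 + N2 + b + 3 + n + n, fun N hN => ?_⟩
    obtain ⟨N', rfl⟩ : ∃ N', N = (b + 1) + n + 1 + N' := ⟨N - b - n - 2, by omega⟩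
    have hab' : a - b = (n : ℤ) + 1 := by omega
    rw [hE N' (by omega), hab', comm_pos n N' (by omega), Finset.sum_range_add,
      Finset.sum_range_succ, Finset.sum_range_add]
    have z1 : ∑ c ∈ Finset.range (b + 1), ((min (c : ℤ) b - min a c : ℤ) : PP) *
        J (a - c) (J (c - b) q) = 0 := by
      apply Finset.sum_eq_zero
      intro c hc
      have hc' := Finset.mem_range.1 hc
      rw [show (min (c : ℤ) b - min a c : ℤ) = 0 by omega]
      simp
    have z2 : ∀ x, J (a - ((b + 1 + n : ℕ) : ℤ)) x = 0 := by
      intro x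
      rw [show (a - ((b + 1 + n : ℕ) : ℤ)) = 0 by omega, J_zero]
    have z3 : |(n : ℤ) + 1| - 1 = n := by rw [abs_of_nonneg (by omega)]; ring
    rw [z1, z2, z3, mul_zero, add_zero, zero_add]
    refine combine' ?_ ?_ ?_
    · · intro k hk
        have hk' := Finset.mem_range.1 hk
        rw [show (min ((b + 1 + k : ℕ) : ℤ) b - min a ((b + 1 + k : ℕ) : ℤ) : ℤ) = -((k : ℤ) + 1) by omega,
          show a - ((b + 1 + k : ℕ) : ℤ) = (n : ℤ) - k by omega,
          show ((b + 1 + k : ℕ) : ℤ) - b = (k : ℤ) + 1 by omega]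
        push_cast; ring
    · · intro k hk
        rw [show (min ((b + 1 + n + 1 + k : ℕ) : ℤ) b - min a ((b + 1 + n + 1 + k : ℕ) : ℤ) : ℤ) = -((n : ℤ) + 1) by omega,
          show a - ((b + 1 + n + 1 + k : ℕ) : ℤ) = -((k : ℤ) + 1) by omega,
          show ((b + 1 + n + 1 + k : ℕ) : ℤ) - b = (n : ℤ) + k + 2 by omega]
        push_cast; ring
    · push_cast; ring

lemma J_C (n : ℤ) (r : RR) (q : PP) : J n (C r * q) = C r * J n q := by
  rcases lt_trichotomy n 0 with h | h | h
  · obtain ⟨k, hk⟩ : ∃ k : ℕ, n = -((k : ℤ) + 1) := ⟨(-n - 1).toNat, by omega⟩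
    rw [Jm k _ _ hk, Jm k _ _ hk]; ring
  · rw [h, J_zero, J_zero, mul_zero]
  · obtain ⟨k, hk⟩ : ∃ k : ℕ, n = (k : ℤ) + 1 := ⟨(n - 1).toNat, by omega⟩
    rw [Jp k _ _ hk, Jp k _ _ hk, pd_C]; ring

lemma Dt_C (r : RR) (q : PP) : Dt (C r * q) = C r * Dt q := by
  obtain ⟨N1, h1⟩ := Dt_trunc q
  obtain ⟨N2, h2⟩ := Dt_trunc (C r * q)
  have e1 := h1 (N1 + N2) (by omega)
  have e2 := h2 (N1 + N2) (by omega)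
  rw [e1, e2, EN_C, mul_smul_comm]

/-- matrix entries -/
def ment (u : ℤ → ℤ → RR) (s : ℤ → RR) (a c : ℤ) (q : PP) : PP :=
  C (u a c) * J (a - c) q + C (if a = c then s a else 0) * q

lemma ment_add (u : ℤ → ℤ → RR) (s : ℤ → RR) (a c : ℤ) (p q : PP) :
    ment u s a c (p + q) = ment u s a c p + ment u s a c q := by
  unfold ment
  rw [J_add]; ring

def mentH (u : ℤ → ℤ → RR) (s : ℤ → RR) (a c : ℤ) : PP →+ PP :=
  AddMonoidHom.mk' (ment u s a c) (ment_add u s a c)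

lemma mentH_apply (u : ℤ → ℤ → RR) (s : ℤ → RR) (a c : ℤ) (q : PP) :
    mentH u s a c q = ment u s a c q := rfl

lemma ment_zero (u : ℤ → ℤ → RR) (s : ℤ → RR) (a c : ℤ) : ment u s a c 0 = 0 :=
  map_zero (mentH u s a c)

lemma ment_finite (u : ℤ → ℤ → RR) (s : ℤ → RR) (c : ℕ) (q : PP) :
    (Function.support (fun a : ℕ => ment u s (a : ℤ) (c : ℤ) q)).Finite := by
  obtain ⟨N, hN⟩ := pderiv_vanish q
  refine (Set.finite_Iio (N + c + 1)).subset fun a ha => ?_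
  by_contra hc
  simp only [Set.mem_Iio, not_lt] at hc
  apply ha
  show ment u s a c q = 0
  unfold ment
  rw [Jp (a - c - 1) q _ (by omega), pd_apply, hN _ (by omega), if_neg (by omega)]
  simp

abbrev MM : Type := ℕ →₀ PP

def rowOp (u : ℤ → ℤ → RR) (s : ℤ → RR) (a : ℤ) : MM →+ PP :=
  Finsupp.liftAddHom (fun c : ℕ => mentH u s a (c : ℤ))

lemma rowOp_single (u : ℤ → ℤ → RR) (s : ℤ → RR) (a : ℤ) (c : ℕ) (q : PP) :
    rowOp u s a (Finsupp.single c q) = ment u s a c q := by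
  unfold rowOp
  rw [Finsupp.liftAddHom_apply_single, mentH_apply]

lemma rowOp_trunc (u : ℤ → ℤ → RR) (s : ℤ → RR) (a : ℤ) (m : MM) (N : ℕ)
    (hN : ∀ c ≥ N, m c = 0) :
    rowOp u s a m = ∑ c ∈ Finset.range N, ment u s a c (m c) := by
  unfold rowOp
  rw [Finsupp.liftAddHom_apply]
  refine Finsupp.sum_of_support_subset _ ?_ _ ?_
  · intro c hc
    by_contra h
    exact (Finsupp.mem_support_iff.1 hc) (hN c (by simpa using h))
  · intro c _
    exact map_zero _

def matOp (u : ℤ → ℤ → RR) (s : ℤ → RR) : MM →+ MM :=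
  Finsupp.liftAddHom (fun c : ℕ => AddMonoidHom.mk'
    (fun q => Finsupp.ofSupportFinite (fun a : ℕ => ment u s (a : ℤ) (c : ℤ) q) (ment_finite u s c q))
    (by
      intro p q
      ext1 a
      exact ment_add u s a c p q))

lemma matOp_single (u : ℤ → ℤ → RR) (s : ℤ → RR) (c : ℕ) (q : PP) (a : ℕ) :
    matOp u s (Finsupp.single c q) a = ment u s a c q := by
  unfold matOp
  rw [Finsupp.liftAddHom_apply_single]
  rfl

lemma matOp_apply (u : ℤ → ℤ → RR) (s : ℤ → RR) (m : MM) (a : ℕ) :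
    matOp u s m a = rowOp u s a m := by
  have : (Finsupp.applyAddHom a).comp (matOp u s) = rowOp u s a := by
    apply Finsupp.addHom_ext
    intro c q
    rw [rowOp_single, AddMonoidHom.comp_apply]
    exact matOp_single u s c q a
  rw [← this]; rfl

lemma exists_bound (m : MM) : ∃ N : ℕ, ∀ c ≥ N, m c = 0 := by
  refine ⟨m.support.sup id + 1, fun n hn => ?_⟩
  by_contra h
  have := Finset.le_sup (f := id) (Finsupp.mem_support_iff.2 h)
  simp only [id] at this
  omega

lemma prod_entry (u u' : ℤ → ℤ → RR) (s s' : ℤ → RR) (a : ℤ) (hs : a < 0 → s a = 0)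
    (b : ℕ) (q : PP) : ∃ N0 : ℕ, ∀ N ≥ N0,
    rowOp u s a (matOp u' s' (Finsupp.single b q)) =
      ∑ c ∈ Finset.range N, C (u a c * u' c b) * J (a - c) (J (c - b) q)
      + (C (u a b * s' b + s a * u' a b) * J (a - b) q + C (if a = b then s a * s' a else 0) * q) := by
  obtain ⟨N1, h1⟩ := exists_bound (matOp u' s' (Finsupp.single b q))
  refine ⟨N1 + b + a.toNat + 1, fun N hN => ?_⟩
  rw [rowOp_trunc u s a _ N (fun c hc => h1 c (by omega))]
  have e : ∀ c ∈ Finset.range N, ment u s a c (matOp u' s' (Finsupp.single b q) c) =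
      C (u a c * u' c b) * J (a - c) (J (c - b) q) +
      ((if c = b then C (u a b * s' b) * J (a - b) q else 0) +
       (if (c : ℤ) = a then C (s a * u' a b) * J (a - b) q + C (if a = b then s a * s' a else 0) * q else 0)) := by
    intro c _
    rw [matOp_single]
    unfold ment
    rw [J_add, J_C, J_C]
    by_cases h1 : c = b
    · subst h1
      by_cases h2 : (c : ℤ) = a
      · subst h2
        simp only [if_true, C_mul]
        ring
      · have h2' : ¬ a = c := fun h => h2 h.symm
        simp only [if_true, if_neg h2, if_neg h2', C_mul, C_0]
        ring
    · have h1' : ¬ (c : ℤ) = b := by omega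
      by_cases h2 : (c : ℤ) = a
      · subst h2
        simp only [if_true, if_neg h1, if_neg h1', C_mul, C_0]
        ring
      · have h2' : ¬ a = c := fun h => h2 h.symm
        simp only [if_neg h1, if_neg h1', if_neg h2, if_neg h2', C_mul, C_0]
        ring
  rw [Finset.sum_congr rfl e, Finset.sum_add_distrib, Finset.sum_add_distrib, Finset.sum_ite_eq',
    if_pos (by simp only [Finset.mem_range]; omega)]
  by_cases ha : a < 0
  · rw [Finset.sum_eq_zero (fun c _ => if_neg (by omega)), hs ha, if_neg (by omega)]
    simp only [C_0, zero_mul, add_zero]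
  · obtain ⟨a', rfl⟩ : ∃ a' : ℕ, a = a' := ⟨a.toNat, by omega⟩
    simp only [Nat.cast_inj]
    rw [Finset.sum_ite_eq', if_pos (by simp only [Finset.mem_range]; omega), C_add]
    ring

def uL : ℤ → ℤ → RR := fun _ _ => 1
def sL : ℤ → RR := fun a => -(hb * bb * (a.toNat : RR))
def uA : ℤ → ℤ → RR := fun a c => ((-(min a c) : ℤ) : RR)
def sA : ℤ → RR := fun a => hb * bb * ((a.toNat.choose 2 : ℕ) : RR)

abbrev rL := rowOp uL sL
abbrev rA := rowOp uA sA
abbrev oL := matOp uL sL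
abbrev oA := matOp uA sA
def DM : MM →+ MM := Finsupp.mapRange.addMonoidHom Dh

lemma DM_single (b : ℕ) (q : PP) : DM (Finsupp.single b q) = Finsupp.single b (Dt q) := by
  unfold DM
  rw [Finsupp.mapRange.addMonoidHom_apply, Finsupp.mapRange_single]
  rfl

lemma two_choose (b : ℕ) : (2 : ℤ) * ((b.choose 2 : ℕ) : ℤ) = b * (b - 1) := by
  induction b with
  | zero => simp
  | succ n ih =>
    rw [Nat.choose_succ_succ' n 1]
    push_cast
    rw [mul_add, ih]; simp; ring

lemma scal (a : ℤ) (ha : -1 ≤ a) (b : ℕ) :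
    2 * ((uA a b * sL b + sA a * uL a b) - (uL a b * sA b + sL a * uA a b))
      = hb * bb * (((a - b) * (|a - b| - 1) : ℤ) : RR) := by
  have key : (2 : ℤ) * (min a b * b + (a.toNat.choose 2 : ℕ) - (b.choose 2 : ℕ)
      - a.toNat * min a b) = (a - b) * (|a - b| - 1) := by
    have h1 := two_choose b
    have h2 := two_choose a.toNat
    rcases lt_or_ge a 0 with h | h
    · have : a = -1 := by omega
      subst this
      rw [min_eq_left (by omega), abs_of_nonpos (by omega)]
      simp at h2 ⊢
      linear_combination - h1
    · obtain ⟨a', rfl⟩ : ∃ a' : ℕ, a = a' := ⟨a.toNat, by omega⟩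
      simp only [Int.toNat_natCast] at h2 ⊢
      rcases le_total (a' : ℤ) b with h | h
      · rw [min_eq_left h, abs_of_nonpos (by omega)]
        linear_combination h2 - h1
      · rw [min_eq_right h, abs_of_nonneg (by omega)]
        linear_combination h2 - h1
  rw [← key]
  unfold uA sL sA uL
  simp only [Int.toNat_natCast]
  push_cast
  ring

lemma lax_single (a : ℤ) (ha : -1 ≤ a) (b : ℕ) (q : PP) :
    Dt (ment uL sL a b q) - ment uL sL a b (Dt q) =
      rA a (oL (Finsupp.single b q)) - rL a (oA (Finsupp.single b q)) := by
  obtain ⟨N1, h1⟩ := key a ha b q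
  obtain ⟨N2, h2⟩ := prod_entry uA uL sA sL a
    (fun h => by unfold sA; rw [show a.toNat = 0 by omega]; simp) b q
  obtain ⟨N3, h3⟩ := prod_entry uL uA sL sA a
    (fun h => by unfold sL; rw [show a.toNat = 0 by omega]; simp) b q
  have e1 := h1 (N1 + N2 + N3) (by omega)
  have e2 := h2 (N1 + N2 + N3) (by omega)
  have e3 := h3 (N1 + N2 + N3) (by omega)
  have e4 : Dt (ment uL sL a b q) - ment uL sL a b (Dt q) = Dt (J (a - b) q) - J (a - b) (Dt q) := by
    unfold ment
    rw [Dt_add, Dt_C, Dt_C]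
    unfold uL
    rw [C_1]; ring
  have e5 : ∑ c ∈ Finset.range (N1 + N2 + N3), ((min (c : ℤ) b - min a c : ℤ) : PP) * J (a - c) (J (c - b) q)
     = ∑ c ∈ Finset.range (N1 + N2 + N3), C (uA a c * uL c b) * J (a - c) (J (c - b) q)
     - ∑ c ∈ Finset.range (N1 + N2 + N3), C (uL a c * uA c b) * J (a - c) (J (c - b) q) := by
    rw [← Finset.sum_sub_distrib]
    refine Finset.sum_congr rfl fun c _ => ?_
    rw [← sub_mul, ← C_sub]
    congr 1
    unfold uA uL
    rw [← map_intCast (C : RR →+* PP)]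
    congr 1
    push_cast
    ring
  have e6 : (C (hb * bb) * (((a - b) * (|a - b| - 1) : ℤ) : PP) : PP) =
      2 * (C (uA a b * sL b + sA a * uL a b) - C (uL a b * sA b + sL a * uA a b)) := by
    rw [← map_intCast (C : RR →+* PP), ← C_mul, ← scal a ha b, ← C_sub, C_mul]
    congr 1
  have e7 : (if a = b then sA a * sL a else 0) = (if a = b then sL a * sA a else 0) := by
    rw [mul_comm]
  have two_ne : (2 : PP) ≠ 0 := two_ne_zero
  apply mul_left_cancel₀ two_ne
  rw [e4, e1, e2, e3, e5, e6, e7]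
  ring

lemma lax_row (a : ℤ) (ha : -1 ≤ a) (m : MM) :
    Dt (rL a m) - rL a (DM m) = rA a (oL m) - rL a (oA m) := by
  have : Dh.comp (rL a) - (rL a).comp DM = (rA a).comp oL - (rL a).comp oA := by
    apply Finsupp.addHom_ext
    intro b q
    simp only [AddMonoidHom.sub_apply, AddMonoidHom.comp_apply, Dh_apply]
    rw [← lax_single a ha, DM_single, rowOp_single, rowOp_single]
  exact DFunLike.congr_fun this m

lemma lax_mat (m : MM) : DM (oL m) - oL (DM m) = oA (oL m) - oL (oA m) := by
  ext1 a
  have := lax_row a (by omega) m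
  simp only [Finsupp.sub_apply, matOp_apply]
  rw [← this, ← matOp_apply uL sL m a]
  rfl

lemma lax_pow_gen {G : Type*} [AddCommGroup G] (D L A : G →+ G)
    (hl : ∀ m, D (L m) - L (D m) = A (L m) - L (A m)) (i : ℕ) (m : G) :
    D (L^[i] m) - L^[i] (D m) = A (L^[i] m) - L^[i] (A m) := by
  induction i generalizing m with
  | zero => simp
  | succ i ih =>
    simp only [Function.iterate_succ_apply]
    have h1 := ih (L m)
    have h2 : L^[i] (D (L m) - L (D m)) = L^[i] (A (L m) - L (A m)) := by rw [hl]
    rw [iterate_map_sub, iterate_map_sub] at h2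
    have h3 : ∀ {x y z w k l : G}, x - y = z - w → y - k = w - l → x - k = z - l := by
      intro x y z w k l h h'
      calc x - k = (x - y) + (y - k) := by abel
        _ = (z - w) + (w - l) := by rw [h, h']
        _ = z - l := by abel
    exact h3 h1 h2

lemma lax_zero_gen {G : Type*} [AddCommGroup G] (D L A : G →+ G)
    (hl : ∀ m, D (L m) - L (D m) = A (L m) - L (A m)) (i : ℕ) (m : G) (hm : A m = 0) :
    D (L^[i] m) = A (L^[i] m) + L^[i] (D m) := by
  have h2 := lax_pow_gen D L A hl i m
  rw [hm, iterate_map_zero, sub_zero] at h2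
  rw [← h2]; abel

def WW (i : ℕ) (p : PP) : PP := rL (-1) (oL^[i] (Finsupp.single 0 p))

lemma oA_single (p : PP) : oA (Finsupp.single 0 p) = 0 := by
  ext1 a
  rw [matOp_single]
  unfold ment uA sA
  rw [show -(min (a : ℤ) ((0 : ℕ) : ℤ)) = 0 by simp]
  by_cases h : (a : ℤ) = ((0 : ℕ) : ℤ)
  · rw [h]; simp
  · rw [if_neg h]; simp

lemma rA_eq (m : MM) : rA (-1) m = rL (-1) m := by
  have : rA (-1) = rL (-1) := by
    apply Finsupp.addHom_ext
    intro c q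
    rw [rowOp_single, rowOp_single]
    unfold ment uA uL
    rw [min_eq_left (by omega), if_neg (by omega), if_neg (by omega)]
    simp
  rw [this]

lemma ad_WW (i : ℕ) : adOp Dt (WW i) = WW (i + 1) := by
  funext p
  have h := lax_zero_gen DM oL oA lax_mat i (Finsupp.single 0 p) (oA_single p)
  rw [DM_single] at h
  have h3 := congrArg (rL (-1)) h
  rw [map_add] at h3
  have h1 := lax_row (-1) le_rfl (oL^[i] (Finsupp.single 0 p))
  rw [rA_eq] at h1
  unfold adOp WW
  rw [Function.iterate_succ_apply']
  linear_combination h1 + h3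

lemma ad_iter (i : ℕ) : (fun B => adOp Dt B)^[i] (J (-1)) = WW i := by
  induction i with
  | zero =>
    funext p
    simp only [Function.iterate_zero, id]
    unfold WW
    rw [Function.iterate_zero, id, rowOp_single]
    unfold ment uL
    rw [if_neg (by omega)]
    simp
  | succ i ih =>
    rw [Function.iterate_succ_apply', ih, ad_WW]

abbrev wz : ℕ → ℤ → List ℤ → PP → PP := wtT (fun _ => 0)

lemma wz_cons (u : ℕ) (y c : ℤ) (hy : -1 ≤ y) (hc : 0 ≤ c) (r : List ℤ) (p : PP) :
    wz u y ((c - y) :: r) p = ment uL sL y c (wz (u + 1) c r p) := by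
  unfold wz ment uL sL
  rw [wtT, Function.comp_apply, add_sub_cancel, C_1, one_mul]
  by_cases h : y = c
  · subst h
    rw [if_pos (sub_self y), if_pos rfl, sub_self, J_zero, zero_add]
    congr 2
    have : ((y.toNat : ℕ) : RR) = (y : RR) := by
      rw [← Int.cast_natCast, Int.toNat_of_nonneg hc]
    rw [this, zero_sub]
  · rw [if_neg (by omega), if_neg h, neg_sub, C_0, zero_mul, add_zero]

def TT (N : ℕ) : Set (List ℤ) := {r | r.sum ≤ 0 ∧ r ∈ BridgeSet (-r.sum) N 0}

lemma bridge_succ (y : ℤ) (N : ℕ) :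
    BridgeSet y (N + 1) 0 = (fun r : List ℤ => (-r.sum - y) :: r) '' TT N := by
  ext L
  constructor
  · rintro ⟨⟨hl, hs⟩, hj⟩
    cases L with
    | nil => simp at hl
    | cons d r =>
      simp only [List.length_cons, Nat.add_right_cancel_iff, List.sum_cons] at hl hs
      have hd : d = -r.sum - y := by omega
      refine ⟨r, ⟨?_, ⟨hl, by omega⟩, ?_⟩, ?_⟩
      · rcases Nat.eq_zero_or_pos N with h | h
        · rw [h, List.length_eq_zero_iff] at hl
          simp [hl]
        · have := hj 1 (by omega) (by omega)
          simp at this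
          omega
      · intro j h0 h1
        have := hj (j + 1) (by omega) (by omega)
        simp only [List.take_succ_cons, List.sum_cons] at this
        omega
      · simp only [hd]
  · rintro ⟨r, ⟨h0, ⟨hl, _⟩, hj⟩, rfl⟩
    refine ⟨⟨by simp [hl], by simp only [List.sum_cons]; ring⟩, ?_⟩
    intro j hj0 hj1
    obtain ⟨k, rfl⟩ : ∃ k, j = k + 1 := ⟨j - 1, by omega⟩
    simp only [List.take_succ_cons, List.sum_cons]
    rcases Nat.eq_zero_or_pos k with h | h
    · subst h; simp; omega
    · have := hj k h (by omega)
      omega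

lemma mem_bridge_sum {y : ℤ} {N : ℕ} {L : List ℤ} (h : L ∈ BridgeSet y N 0) : y = -L.sum := by
  have := h.1.2
  omega

lemma TT_finite (N : ℕ) (p : PP) : ∀ u : ℕ, {r ∈ TT N | wz u (-r.sum) r p ≠ 0}.Finite := by
  induction N with
  | zero =>
    intro u
    refine (Set.finite_singleton ([] : List ℤ)).subset ?_
    rintro r ⟨hr, _⟩
    exact List.length_eq_zero_iff.1 hr.2.1.1
  | succ N ih =>
    intro u
    have hf := (ih (u + 1)).biUnion (t := fun r => (fun a : ℕ => (-r.sum - (a : ℤ)) :: r) ''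
      (Function.support (fun a : ℕ => ment uL sL (a : ℤ) (((-r.sum).toNat : ℕ) : ℤ)
        (wz (u + 1) (-r.sum) r p)))) (fun r _ => (ment_finite _ _ _ _).image _)
    refine hf.subset ?_
    rintro L ⟨⟨hL0, hL⟩, hne⟩
    rw [bridge_succ] at hL
    obtain ⟨r, hr, hrL⟩ := hL
    obtain ⟨a, ha⟩ : ∃ a : ℕ, -L.sum = a := ⟨(-L.sum).toNat, by omega⟩
    have hr0 := hr.1
    rw [ha] at hne
    simp only [ha] at hrL
    subst hrL
    rw [wz_cons u a (-r.sum) (by omega) (by omega)] at hne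
    have hc : (((-r.sum).toNat : ℕ) : ℤ) = -r.sum := Int.toNat_of_nonneg (by omega)
    simp only [Set.mem_iUnion]
    refine ⟨r, ⟨hr, ?_⟩, a, ?_, rfl⟩
    · intro h
      rw [h, ment_zero] at hne
      exact hne rfl
    · rw [Function.mem_support, hc]
      exact hne

def SS (u N : ℕ) (p : PP) : MM :=
  ∑ᶠ r ∈ TT N, Finsupp.single (-r.sum).toNat (wz u (-r.sum) r p)

lemma SS_finite (u N : ℕ) (p : PP) :
    (TT N ∩ Function.support (fun r => (Finsupp.single (-r.sum).toNat (wz u (-r.sum) r p) : MM))).Finite := by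
  refine (TT_finite N p u).subset ?_
  rintro r ⟨h1, h2⟩
  refine ⟨h1, fun h => h2 ?_⟩
  simp only [h, Finsupp.single_zero]

lemma cons_inj (y : ℤ) : Function.Injective (fun r : List ℤ => (-r.sum - y) :: r) := by
  intro r r' h
  exact (List.cons.inj h).2

lemma row_SS (u N : ℕ) (p : PP) (y : ℤ) (hy : -1 ≤ y) :
    rL y (SS (u + 1) N p) = ∑ᶠ L ∈ BridgeSet y (N + 1) 0, wz u y L p := by
  rw [bridge_succ, finsum_mem_image (cons_inj y).injOn]
  unfold SS
  rw [AddMonoidHom.map_finsum_mem' _ (SS_finite (u + 1) N p)]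
  refine finsum_mem_congr rfl fun r hr => ?_
  have hr0 := hr.1
  have hc : (((-r.sum).toNat : ℕ) : ℤ) = -r.sum := Int.toNat_of_nonneg (by omega)
  rw [rowOp_single, hc, wz_cons u y (-r.sum) hy (by omega)]

lemma SS_eq (N : ℕ) (p : PP) : ∀ u, oL^[N] (Finsupp.single 0 p) = SS u N p := by
  induction N with
  | zero =>
    intro u
    have : TT 0 = {[]} := by
      ext r
      constructor
      · intro hr
        exact List.length_eq_zero_iff.1 hr.2.1.1
      · rintro rfl
        exact ⟨by simp, ⟨by simp, by simp⟩, fun j h1 h2 => by omega⟩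
    unfold SS
    rw [this, finsum_mem_singleton]
    simp [wtT]
  | succ N ih =>
    intro u
    rw [Function.iterate_succ_apply', ih (u + 1)]
    ext1 a
    rw [matOp_apply, row_SS u N p a (by omega)]
    have h := AddMonoidHom.map_finsum_mem' (Finsupp.applyAddHom a) (SS_finite u (N + 1) p)
    refine Eq.trans ?_ h.symm
    rw [finsum_mem_def, finsum_mem_def]
    refine finsum_congr fun L => ?_
    by_cases hB : L ∈ BridgeSet (a : ℤ) (N + 1) 0
    · have hs := mem_bridge_sum hB
      have hT : L ∈ TT (N + 1) := ⟨by omega, by rw [← hs]; exact hB⟩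
      rw [Set.indicator_of_mem hB, Set.indicator_of_mem hT, Finsupp.applyAddHom_apply, ← hs,
        Int.toNat_natCast, Finsupp.single_eq_same]
    · rw [Set.indicator_of_notMem hB]
      by_cases hT : L ∈ TT (N + 1)
      · rw [Set.indicator_of_mem hT, Finsupp.applyAddHom_apply, Finsupp.single_apply, if_neg]
        intro h
        apply hB
        have h0 := hT.1
        rw [show (a : ℤ) = -L.sum by omega]
        exact hT.2
      · rw [Set.indicator_of_notMem hT]

/-- **Lemma 2.8 of the paper.** For every `i ≥ 0`, one has the identity of `R`-linear
operators on `R[p̃]` (with `R = ℚ[ℏ,𝔟]`):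
`Ad_{D̃}^{i}(J_{−1}) = Σ_{γ ∈ Γ^{≥0}_{(0,−1)→(i+1,0)}} wt̃(γ|0)`,
where the sum over bridges is locally finite. -/
theorem stmt3 (i : ℕ) :
    (∀ p : PP,
        {L ∈ BridgeSet (-1) (i + 1) 0 | wtT (fun _ => 0) 1 (-1) L p ≠ 0}.Finite) ∧
    (∀ p : PP,
        (fun B => adOp Dt B)^[i] (J (-1)) p
          = ∑ᶠ L ∈ BridgeSet (-1) (i + 1) 0, wtT (fun _ => 0) 1 (-1) L p) := by
  refine ⟨fun p => ?_, fun p => ?_⟩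
  · refine ((TT_finite i p 2).image (fun r : List ℤ => (-r.sum - (-1)) :: r)).subset ?_
    rintro L ⟨hL, hne⟩
    rw [bridge_succ] at hL
    obtain ⟨r, hr, rfl⟩ := hL
    refine ⟨r, ⟨hr, fun h => hne ?_⟩, rfl⟩
    have hr0 := hr.1
    have h2 := wz_cons 1 (-1) (-r.sum) le_rfl (by omega) r p
    rw [h, ment_zero] at h2
    exact h2
  · rw [ad_iter, ← row_SS 1 i p (-1) le_rfl, ← SS_eq]
    rfl

end Stmt3
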